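/- Let $0 < \eta \le 1/204$ and consider the region $P_4 \subset \mathbb{R}^4$ of points $(x_1,x_2,x_3,x_4)$ with $x_1 \ge x_2 \ge x_3 \ge x_4 > 0$, $3x_1 \le 7/12+\eta$, $x_1 + x_2 + 3x_3 \le 7/12+\eta$, $x_1 < 1/6 + 2\eta$, and $x_2 + x_4 > 1/4 - 3\eta$. Then every point of $P_4$ satisfies $x_2 > 1/6 - 10\eta$ and $x_4 > 1/12 - 13\eta$, and consequently the Lebesgue measure of $P_4$ is $O(\eta^4)$. -/

import Mathlib

/-- The exceptional polytope `P₄` of the modified linear sieve: every point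
satisfies `x₂ > 1/6 - 10η` and `x₄ > 1/12 - 13η`, hence its Lebesgue
measure is `O(η⁴)`. -/
theorem stmt_16 :
    ∃ C : ℝ, 0 < C ∧ ∀ η : ℝ, 0 < η → η ≤ 1/204 →
      ∀ S : Set (ℝ × ℝ × ℝ × ℝ),
        S = {p : ℝ × ℝ × ℝ × ℝ |
          0 < p.2.2.2 ∧ p.2.2.2 ≤ p.2.2.1 ∧ p.2.2.1 ≤ p.2.1 ∧ p.2.1 ≤ p.1 ∧
          3 * p.1 ≤ 7/12 + η ∧
          p.1 + p.2.1 + 3 * p.2.2.1 ≤ 7/12 + η ∧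
          p.1 < 1/6 + 2*η ∧
          1/4 - 3*η < p.2.1 + p.2.2.2} →
        (∀ p ∈ S, 1/6 - 10*η < p.2.1 ∧ 1/12 - 13*η < p.2.2.2) ∧
        MeasureTheory.volume S ≤ ENNReal.ofReal (C * η^4) := by
  refine ⟨57600, by norm_num, ?_⟩
  intro η h0 _ S hS
  have key : ∀ p ∈ S, 1/6 - 10*η < p.2.1 ∧ 1/12 - 13*η < p.2.2.2 := by
    intro p hp
    rw [hS] at hp
    obtain ⟨h1, h2, h3, h4, h5, h6, h7, h8⟩ := hp
    constructor <;> linarith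
  refine ⟨key, ?_⟩
  have hsub : S ⊆ (Set.Icc (1/6 - 10*η) (1/6 + 2*η)) ×ˢ ((Set.Icc (1/6 - 10*η) (1/6 + 2*η)) ×ˢ
      ((Set.Icc (1/12 - 13*η) (1/12 + 7*η)) ×ˢ (Set.Icc (1/12 - 13*η) (1/12 + 7*η)))) := by
    intro p hp
    obtain ⟨k1, k2⟩ := key p hp
    rw [hS] at hp
    obtain ⟨h1, h2, h3, h4, h5, h6, h7, h8⟩ := hp
    simp only [Set.mem_prod, Set.mem_Icc]
    refine ⟨⟨?_, ?_⟩, ⟨?_, ?_⟩, ⟨?_, ?_⟩, ?_, ?_⟩ <;> linarith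
  refine (MeasureTheory.measure_mono hsub).trans (le_of_eq ?_)
  rw [MeasureTheory.Measure.volume_eq_prod, MeasureTheory.Measure.prod_prod,
    MeasureTheory.Measure.volume_eq_prod, MeasureTheory.Measure.prod_prod,
    MeasureTheory.Measure.volume_eq_prod, MeasureTheory.Measure.prod_prod,
    Real.volume_Icc, Real.volume_Icc,
    ← ENNReal.ofReal_mul (by linarith), ← ENNReal.ofReal_mul (by linarith),
    ← ENNReal.ofReal_mul (by linarith)]
  congr 1
  ring
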